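/- arXiv:1607.00175 — 2 statements merged into one kernel-verified Lean document; each statement's English description precedes it below -/
import Mathlib

section
/- For every statistics parameter θ ∈ {−1, 0, 1}, every admissible fugacity z and every temperature parameter T > 0, the 13×13 matrix M₁ is diagonalizable over ℝ with all eigenvalues real. (This is the global hyperbolicity of the regularized quantum 13-moment system, whose coefficient matrix A₁ᴿ is similar to M₁ + u₁·I.) -/
open Real Matrix

/-- The quantum polylogarithm `𝓛_s(z)`. -/
noncomputable def qpolylog (θ s z : ℝ) : ℝ :=
  (1 / Real.Gamma s) * ∫ t in Set.Ioi (0:ℝ), t ^ (s - 1) / (z⁻¹ * Real.exp t + θ)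

/-- Admissible fugacity: `z > 0`, and additionally `z < 1` for Bosons (`θ = -1`). -/
def admissible (θ z : ℝ) : Prop := 0 < z ∧ (θ = -1 → z < 1)

/-- The coefficient matrix `M₁` of the regularized quantum 13-moment system. -/
noncomputable def M1 (θ z T : ℝ) : Matrix (Fin 13) (Fin 13) ℝ :=
  let L1 := qpolylog θ (1/2) z
  let L3 := qpolylog θ (3/2) z
  let L5 := qpolylog θ (5/2) z
  let L7 := qpolylog θ (7/2) z
  let m1 := (L7 / L5) * T
  let m2 := (1/2) * (1 - L5^2 / (L3 * L7))
  let b := 2 / (5 - 3 * L5^2 / (L3 * L7))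
  let m3 := (5/(6*b)) * (T / (5 * L1 / L3 - 3 * L3 / L5)) *
      (2 * L1 * L7 / (L3 * L5) - 3 * (1 - L3 * L7 / L5^2))
  Matrix.of
    ![![0, 1, 0, 0, 0, 0, 0, 0, 0, 0, 0, 0, 0],
      ![T * L5 / L3, 0, 0, 0, 1 + m2, 0, 0, m2, 0, m2, 0, 0, 0],
      ![0, 0, 0, 0, 0, 1, 0, 0, 0, 0, 0, 0, 0],
      ![0, 0, 0, 0, 0, 0, 1, 0, 0, 0, 0, 0, 0],
      ![0, 2 * m1, 0, 0, 0, 0, 0, 0, 0, 0, 2*b/3 + 8/15, 0, 0],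
      ![0, 0, m1, 0, 0, 0, 0, 0, 0, 0, 0, 2/5, 0],
      ![0, 0, 0, m1, 0, 0, 0, 0, 0, 0, 0, 0, 2/5],
      ![0, 0, 0, 0, 0, 0, 0, 0, 0, 0, 2*b/3 - 4/15, 0, 0],
      ![0, 0, 0, 0, 0, 0, 0, 0, 0, 0, 0, 0, 0],
      ![0, 0, 0, 0, 0, 0, 0, 0, 0, 0, 2*b/3 - 4/15, 0, 0],
      ![0, 0, 0, 0, m3 + 2*m1/3, 0, 0, m3 - m1/3, 0, m3 - m1/3, 0, 0, 0],
      ![0, 0, 0, 0, 0, m1, 0, 0, 0, 0, 0, 0, 0],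
      ![0, 0, 0, 0, 0, 0, m1, 0, 0, 0, 0, 0, 0]]

section Diagonalization

variable {V : Type*} [AddCommGroup V] [Module ℝ V]

/-- The span of all real eigenvectors of an endomorphism. -/
def eigenSpan (f : Module.End ℝ V) : Submodule ℝ V :=
  Submodule.span ℝ {v | ∃ μ : ℝ, f v = μ • v}

theorem mem_eigenSpan {f : Module.End ℝ V} {v : V} (μ : ℝ) (h : f v = μ • v) :
    v ∈ eigenSpan f :=
  Submodule.subset_span ⟨μ, h⟩

theorem mem_eigenSpan_of_sq {f : Module.End ℝ V} {v : V} {l : ℝ} (hl : 0 < l)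
    (h : f (f v) = l • v) : v ∈ eigenSpan f := by
  have hs : 0 < √l := Real.sqrt_pos.2 hl
  have hl' : l = √l * √l := (Real.mul_self_sqrt hl.le).symm
  have h₁ : f v + √l • v ∈ eigenSpan f := by
    refine mem_eigenSpan (√l) ?_
    rw [map_add, map_smul, h, smul_add, smul_smul, ← hl', add_comm]
  have h₂ : f v - √l • v ∈ eigenSpan f := by
    refine mem_eigenSpan (-√l) ?_
    rw [map_sub, map_smul, h, smul_sub, smul_smul, neg_mul, ← hl']
    module
  have hv : v = (2 * √l)⁻¹ • ((f v + √l • v) - (f v - √l • v)) := by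
    rw [show (f v + √l • v) - (f v - √l • v) = (2 * √l) • v by module, smul_smul,
      inv_mul_cancel₀ (by positivity), one_smul]
  rw [hv]
  exact Submodule.smul_mem _ _ (Submodule.sub_mem _ h₁ h₂)

theorem mem_eigenSpan_of_cubic {f : Module.End ℝ V} {v : V} {l : ℝ} (hl : 0 < l)
    (h : f (f (f v)) = l • f v) : v ∈ eigenSpan f := by
  have h₁ : f (f v) ∈ eigenSpan f := mem_eigenSpan_of_sq hl (by rw [h, map_smul])
  have h₂ : l • v - f (f v) ∈ eigenSpan f :=
    mem_eigenSpan 0 (by rw [map_sub, map_smul, h, sub_self, zero_smul])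
  have hv : v = l⁻¹ • ((l • v - f (f v)) + f (f v)) := by
    rw [sub_add_cancel, smul_smul, inv_mul_cancel₀ hl.ne', one_smul]
  rw [hv]
  exact Submodule.smul_mem _ _ (Submodule.add_mem _ h₂ h₁)

theorem mem_eigenSpan_of_biquadratic {f : Module.End ℝ V} {v : V} {l r : ℝ} (hl : 0 < l)
    (hr : 0 < r) (hlr : l ≠ r)
    (h : f (f (f (f v))) = (l + r) • f (f v) - (l * r) • v) : v ∈ eigenSpan f := by
  have h₁ : f (f v) - r • v ∈ eigenSpan f := by
    refine mem_eigenSpan_of_sq hl ?_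
    rw [map_sub, map_sub, map_smul, map_smul, h]
    module
  have h₂ : f (f v) - l • v ∈ eigenSpan f := by
    refine mem_eigenSpan_of_sq hr ?_
    rw [map_sub, map_sub, map_smul, map_smul, h]
    module
  have hv : v = (l - r)⁻¹ • ((f (f v) - r • v) - (f (f v) - l • v)) := by
    rw [show (f (f v) - r • v) - (f (f v) - l • v) = (l - r) • v by module, smul_smul,
      inv_mul_cancel₀ (sub_ne_zero.2 hlr), one_smul]
  rw [hv]
  exact Submodule.smul_mem _ _ (Submodule.sub_mem _ h₁ h₂)

/-- A vector annihilated by `X (X⁴ - t X² + d)`, where `Y² - t Y + d` has two distinct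
positive roots, is a sum of real eigenvectors. -/
theorem mem_eigenSpan_of_quintic {f : Module.End ℝ V} {v : V} {t d : ℝ} (ht : 0 < t)
    (hd : 0 < d) (htd : 4 * d < t ^ 2)
    (h : f (f (f (f (f v)))) = t • f (f (f v)) - d • f v) : v ∈ eigenSpan f := by
  obtain ⟨l, r, hl, hr, hlr, rfl, rfl⟩ :
      ∃ l r : ℝ, 0 < l ∧ 0 < r ∧ l ≠ r ∧ t = l + r ∧ d = l * r := by
    have hΔ : 0 < √(t ^ 2 - 4 * d) := Real.sqrt_pos.2 (by linarith)
    have hsq : √(t ^ 2 - 4 * d) ^ 2 = t ^ 2 - 4 * d := Real.sq_sqrt (by linarith)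
    have hlt : √(t ^ 2 - 4 * d) < t := by
      rw [Real.sqrt_lt' ht]
      linarith
    refine ⟨(t + √(t ^ 2 - 4 * d)) / 2, (t - √(t ^ 2 - 4 * d)) / 2, by linarith, by linarith,
      fun h => by linarith, by ring, by linear_combination hsq / 4⟩
  have h₁ : f v ∈ eigenSpan f := mem_eigenSpan_of_biquadratic hl hr hlr h
  have h₂ : f (f (f (f v))) - (l + r) • f (f v) + (l * r) • v ∈ eigenSpan f := by
    refine mem_eigenSpan 0 ?_
    rw [map_add, map_sub, map_smul, map_smul, h]
    module
  have hinv : ∀ w ∈ eigenSpan f, f w ∈ eigenSpan f := by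
    intro w hw
    induction hw using Submodule.span_induction with
    | mem x hx =>
      obtain ⟨μ, hμ⟩ := hx
      exact hμ ▸ Submodule.smul_mem _ _ (mem_eigenSpan μ hμ)
    | zero => simp
    | add x y _ _ hx hy => exact map_add f x y ▸ Submodule.add_mem _ hx hy
    | smul c x _ hx => exact map_smul f c x ▸ Submodule.smul_mem _ _ hx
  have hff := hinv _ h₁
  have hv : v = (l * r)⁻¹ • ((f (f (f (f v))) - (l + r) • f (f v) + (l * r) • v)
      - f (f (f (f v))) + (l + r) • f (f v)) := by
    rw [show (f (f (f (f v))) - (l + r) • f (f v) + (l * r) • v)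
      - f (f (f (f v))) + (l + r) • f (f v) = (l * r) • v by module, smul_smul,
      inv_mul_cancel₀ (by positivity), one_smul]
  rw [hv]
  exact Submodule.smul_mem _ _ (Submodule.add_mem _
    (Submodule.sub_mem _ h₂ (hinv _ (hinv _ hff))) (Submodule.smul_mem _ _ hff))

variable {n : Type*} [Fintype n] [DecidableEq n]

theorem exists_isDiag_of_eigenSpan_eq_top {A : Matrix n n ℝ}
    (h : eigenSpan A.mulVecLin = ⊤) :
    ∃ P : Matrix n n ℝ, IsUnit P.det ∧ (P⁻¹ * A * P).IsDiag := by
  let b₀ := Module.Basis.ofSpan h.ge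
  have hcard := Module.Basis.indexEquiv b₀ (Pi.basisFun ℝ n)
  let b := b₀.reindex hcard
  have hb : ∀ j, ∃ μ : ℝ, A *ᵥ b j = μ • b j := fun j =>
    Module.Basis.ofSpan_subset h.ge ⟨hcard.symm j, (b₀.reindex_apply hcard j).symm⟩
  choose d hd using hb
  let P : Matrix n n ℝ := (Pi.basisFun ℝ n).toMatrix b
  have hP : IsUnit P.det := by
    have := (Pi.basisFun ℝ n).invertibleToMatrix b
    exact (Matrix.isUnit_iff_isUnit_det P).1 (isUnit_of_invertible P)
  have hAP : A * P = P * diagonal d := by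
    ext i j
    rw [mul_diagonal]
    have := congrFun (hd j) i
    simpa [P, Module.Basis.toMatrix_apply, Matrix.mul_apply, mulVec, dotProduct, mul_comm]
      using this
  refine ⟨P, hP, ?_⟩
  rw [mul_assoc, hAP, ← mul_assoc, Matrix.nonsing_inv_mul P hP, one_mul]
  exact isDiag_diagonal d

theorem charpoly_roots_real_of_isDiag {A P : Matrix n n ℝ} (hP : IsUnit P.det)
    (h : (P⁻¹ * A * P).IsDiag) :
    ∀ μ ∈ (A.map (algebraMap ℝ ℂ)).charpoly.roots, μ.im = 0 := by
  intro μ hμ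
  have hA : A.charpoly = (P⁻¹ * A * P).charpoly := by
    rw [charpoly_mul_comm, ← mul_assoc, Matrix.mul_nonsing_inv P hP, one_mul]
  rw [charpoly_map, hA, ← h.diagonal_diag, charpoly_diagonal, Polynomial.map_prod] at hμ
  have hroot := Polynomial.isRoot_of_mem_roots hμ
  simp only [Polynomial.IsRoot, Polynomial.eval_prod, Finset.prod_eq_zero_iff] at hroot
  obtain ⟨i, -, hi⟩ := hroot
  simp [sub_eq_zero] at hi
  simp [hi]

end Diagonalization

/-- The sparsity pattern of `M1`, with arbitrary entries. -/
noncomputable def blockMatrix (a p q k g h u w m : ℝ) : Matrix (Fin 13) (Fin 13) ℝ :=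
  Matrix.of
    ![![0, 1, 0, 0, 0, 0, 0, 0, 0, 0, 0, 0, 0],
      ![a, 0, 0, 0, p, 0, 0, q, 0, q, 0, 0, 0],
      ![0, 0, 0, 0, 0, 1, 0, 0, 0, 0, 0, 0, 0],
      ![0, 0, 0, 0, 0, 0, 1, 0, 0, 0, 0, 0, 0],
      ![0, k, 0, 0, 0, 0, 0, 0, 0, 0, g, 0, 0],
      ![0, 0, m, 0, 0, 0, 0, 0, 0, 0, 0, 2/5, 0],
      ![0, 0, 0, m, 0, 0, 0, 0, 0, 0, 0, 0, 2/5],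
      ![0, 0, 0, 0, 0, 0, 0, 0, 0, 0, h, 0, 0],
      ![0, 0, 0, 0, 0, 0, 0, 0, 0, 0, 0, 0, 0],
      ![0, 0, 0, 0, 0, 0, 0, 0, 0, 0, h, 0, 0],
      ![0, 0, 0, 0, u, 0, 0, w, 0, w, 0, 0, 0],
      ![0, 0, 0, 0, 0, m, 0, 0, 0, 0, 0, 0, 0],
      ![0, 0, 0, 0, 0, 0, m, 0, 0, 0, 0, 0, 0]]

theorem blockMatrix_mulVec (a p q k g h u w m : ℝ) (v : Fin 13 → ℝ) :
    blockMatrix a p q k g h u w m *ᵥ v =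
      ![v 1, a * v 0 + p * v 4 + q * v 7 + q * v 9, v 5, v 6, k * v 1 + g * v 10,
        m * v 2 + 2 / 5 * v 11, m * v 3 + 2 / 5 * v 12, h * v 10, 0, h * v 10,
        u * v 4 + w * v 7 + w * v 9, m * v 5, m * v 6] := by
  ext i
  fin_cases i <;>
    simp [blockMatrix, mulVec, dotProduct, Fin.sum_univ_succ] <;> ring

theorem blockMatrix_mulVec_longitudinal (a p q k g h u w m x₀ x₁ x₄ x₇ x₉ x₁₀ : ℝ) :
    blockMatrix a p q k g h u w m *ᵥ ![x₀, x₁, 0, 0, x₄, 0, 0, x₇, 0, x₉, x₁₀, 0, 0] =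
      ![x₁, a * x₀ + p * x₄ + q * x₇ + q * x₉, 0, 0, k * x₁ + g * x₁₀, 0, 0, h * x₁₀, 0,
        h * x₁₀, u * x₄ + w * x₇ + w * x₉, 0, 0] := by
  rw [blockMatrix_mulVec]
  ext i
  fin_cases i <;> simp

theorem blockMatrix_mulVec_transverse (a p q k g h u w m x₂ x₃ x₅ x₆ x₈ x₁₁ x₁₂ : ℝ) :
    blockMatrix a p q k g h u w m *ᵥ ![0, 0, x₂, x₃, 0, x₅, x₆, 0, x₈, 0, 0, x₁₁, x₁₂] =
      ![0, 0, x₅, x₆, 0, m * x₂ + 2 / 5 * x₁₁, m * x₃ + 2 / 5 * x₁₂, 0, 0, 0, 0,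
        m * x₅, m * x₆] := by
  rw [blockMatrix_mulVec]
  ext i
  fin_cases i <;> simp

/-- On the coordinates `0, 1, 4, 7, 9, 10`, the squares of the nonzero eigenvalues are the
eigenvalues of a `2 × 2` matrix with trace `t` and determinant `d`. -/
theorem eigenSpan_blockMatrix_eq_top {a p q k g h u w m t d : ℝ} (hm : 0 < m)
    (ht : t = (a + p * k) + (u * g + 2 * w * h))
    (hd : d = (a + p * k) * (u * g + 2 * w * h) - (p * g + 2 * q * h) * (u * k))
    (ht₀ : 0 < t) (hd₀ : 0 < d) (htd : 4 * d < t ^ 2) :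
    eigenSpan (blockMatrix a p q k g h u w m).mulVecLin = ⊤ := by
  rw [eq_top_iff]
  rintro v -
  have hv : v = ![v 0, v 1, 0, 0, v 4, 0, 0, v 7, 0, v 9, v 10, 0, 0] +
      ![0, 0, v 2, v 3, 0, v 5, v 6, 0, v 8, 0, 0, v 11, v 12] := by
    ext i
    fin_cases i <;> simp
  rw [hv]
  refine Submodule.add_mem _ (mem_eigenSpan_of_quintic ht₀ hd₀ htd ?_)
    (mem_eigenSpan_of_cubic (l := 7 / 5 * m) (by positivity) ?_)
  · simp only [mulVecLin_apply, blockMatrix_mulVec_longitudinal, ht, hd]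
    ext i
    fin_cases i <;> simp <;> ring
  · simp only [mulVecLin_apply, blockMatrix_mulVec_transverse]
    ext i
    fin_cases i <;> simp <;> ring

/-- The negative derivative of the occupation number `1 / (z⁻¹ eᵗ + θ)`. -/
noncomputable def occupationDecay (θ z t : ℝ) : ℝ :=
  z⁻¹ * Real.exp t / (z⁻¹ * Real.exp t + θ) ^ 2

/-- The `p`-th moment of `occupationDecay` over the positive half-line. -/
noncomputable def occupationMoment (θ z p : ℝ) : ℝ :=
  ∫ t in Set.Ioi (0:ℝ), t ^ p * occupationDecay θ z t

section Moments

open MeasureTheory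

variable {θ z : ℝ}

theorem exists_mul_exp_le (hθ : θ = -1 ∨ θ = 0 ∨ θ = 1) (hz : admissible θ z) :
    ∃ c > 0, ∀ t ≥ 0, c * Real.exp t ≤ z⁻¹ * Real.exp t + θ := by
  obtain ⟨hz₀, hz₁⟩ := hz
  have hzi : 0 < z⁻¹ := inv_pos.2 hz₀
  rcases hθ with rfl | rfl | rfl
  · refine ⟨z⁻¹ - 1, sub_pos.2 ((one_lt_inv₀ hz₀).2 (hz₁ rfl)), fun t ht => ?_⟩
    linarith [Real.one_le_exp ht]
  · exact ⟨z⁻¹, hzi, fun t _ => by simp⟩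
  · exact ⟨z⁻¹, hzi, fun t _ => by simp⟩

theorem integrableOn_rpow_mul_of_le_exp_neg {p C : ℝ} {f : ℝ → ℝ} (hp : -1 < p)
    (hf : Measurable f) (hfC : ∀ t > 0, |f t| ≤ C * Real.exp (-t)) :
    IntegrableOn (fun t => t ^ p * f t) (Set.Ioi 0) := by
  have hG := (Real.GammaIntegral_convergent (s := p + 1) (by linarith)).const_mul C
  refine Integrable.mono' hG (by fun_prop) ?_
  filter_upwards [ae_restrict_mem measurableSet_Ioi] with t ht
  have ht' : 0 ≤ t ^ p := Real.rpow_nonneg (le_of_lt ht) p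
  rw [Real.norm_eq_abs, abs_mul, abs_of_nonneg ht', add_sub_cancel_right]
  nlinarith [mul_le_mul_of_nonneg_left (hfC t ht) ht']

theorem denom_pos (hθ : θ = -1 ∨ θ = 0 ∨ θ = 1) (hz : admissible θ z) {t : ℝ} (ht : 0 ≤ t) :
    0 < z⁻¹ * Real.exp t + θ := by
  obtain ⟨c, hc, h⟩ := exists_mul_exp_le hθ hz
  exact lt_of_lt_of_le (by positivity) (h t ht)

theorem occupationDecay_pos (hθ : θ = -1 ∨ θ = 0 ∨ θ = 1) (hz : admissible θ z) {t : ℝ}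
    (ht : 0 ≤ t) : 0 < occupationDecay θ z t :=
  div_pos (mul_pos (inv_pos.2 hz.1) (Real.exp_pos t)) (pow_pos (denom_pos hθ hz ht) 2)

theorem exists_inv_denom_le (hθ : θ = -1 ∨ θ = 0 ∨ θ = 1) (hz : admissible θ z) :
    ∃ C, ∀ t ≥ 0, (z⁻¹ * Real.exp t + θ)⁻¹ ≤ C * Real.exp (-t) := by
  obtain ⟨c, hc, h⟩ := exists_mul_exp_le hθ hz
  refine ⟨c⁻¹, fun t ht => ?_⟩
  rw [Real.exp_neg, ← mul_inv]
  exact inv_anti₀ (by positivity) (h t ht)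

theorem integrableOn_rpow_mul_inv_denom (hθ : θ = -1 ∨ θ = 0 ∨ θ = 1) (hz : admissible θ z)
    {p : ℝ} (hp : -1 < p) :
    IntegrableOn (fun t => t ^ p * (z⁻¹ * Real.exp t + θ)⁻¹) (Set.Ioi 0) := by
  obtain ⟨C, h⟩ := exists_inv_denom_le hθ hz
  refine integrableOn_rpow_mul_of_le_exp_neg (C := C) hp (by fun_prop) fun t ht => ?_
  rw [abs_of_pos (inv_pos.2 (denom_pos hθ hz (le_of_lt ht)))]
  exact h t (le_of_lt ht)

theorem integrableOn_rpow_mul_occupationDecay (hθ : θ = -1 ∨ θ = 0 ∨ θ = 1)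
    (hz : admissible θ z) {p : ℝ} (hp : -1 < p) :
    IntegrableOn (fun t => t ^ p * occupationDecay θ z t) (Set.Ioi 0) := by
  obtain ⟨C, h⟩ := exists_inv_denom_le hθ hz
  refine integrableOn_rpow_mul_of_le_exp_neg (C := z⁻¹ * C ^ 2) hp
    (by unfold occupationDecay; fun_prop) fun t ht => ?_
  have ht' : 0 ≤ t := le_of_lt ht
  rw [abs_of_pos (occupationDecay_pos hθ hz ht'), occupationDecay, div_eq_mul_inv, ← inv_pow]
  have hz₀ : 0 < z⁻¹ := inv_pos.2 hz.1
  have hD : 0 ≤ (z⁻¹ * Real.exp t + θ)⁻¹ := (inv_pos.2 (denom_pos hθ hz ht')).le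
  calc z⁻¹ * Real.exp t * (z⁻¹ * Real.exp t + θ)⁻¹ ^ 2
      ≤ z⁻¹ * Real.exp t * (C * Real.exp (-t)) ^ 2 := by gcongr; exact h t ht'
    _ = z⁻¹ * C ^ 2 * Real.exp (-t) * (Real.exp t * Real.exp (-t)) := by ring
    _ = z⁻¹ * C ^ 2 * Real.exp (-t) := by rw [← Real.exp_add, add_neg_cancel, Real.exp_zero, mul_one]

theorem integral_rpow_mul_inv_denom (hθ : θ = -1 ∨ θ = 0 ∨ θ = 1) (hz : admissible θ z)
    {s : ℝ} (hs : 0 < s) :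
    s * ∫ t in Set.Ioi (0:ℝ), t ^ (s - 1) * (z⁻¹ * Real.exp t + θ)⁻¹ =
      occupationMoment θ z s := by
  have hI₁ := (integrableOn_rpow_mul_inv_denom hθ hz (p := s - 1) (by linarith)).const_mul s
  have hI₂ := integrableOn_rpow_mul_occupationDecay hθ hz (p := s) (by linarith)
  have hderiv : ∀ t ∈ Set.Ioi (0:ℝ),
      HasDerivAt (fun t => t ^ s * (z⁻¹ * Real.exp t + θ)⁻¹)
        (s * (t ^ (s - 1) * (z⁻¹ * Real.exp t + θ)⁻¹) - t ^ s * occupationDecay θ z t) t := by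
    intro t ht
    have hD := denom_pos hθ hz (le_of_lt ht)
    have h₁ := Real.hasDerivAt_rpow_const (x := t) (p := s) (Or.inl (ne_of_gt ht))
    have h₂ := (((Real.hasDerivAt_exp t).const_mul z⁻¹).add_const θ).inv hD.ne'
    refine (h₁.mul h₂).congr_deriv ?_
    simp only [occupationDecay, Pi.inv_apply]
    ring
  have hcont : ContinuousWithinAt (fun t => t ^ s * (z⁻¹ * Real.exp t + θ)⁻¹)
      (Set.Ici 0) 0 := by
    refine ContinuousAt.continuousWithinAt ?_
    refine (Real.continuousAt_rpow_const 0 s (Or.inr hs.le)).mul (ContinuousAt.inv₀ ?_ ?_)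
    · fun_prop
    · exact (denom_pos hθ hz le_rfl).ne'
  have hlim : Filter.Tendsto (fun t => t ^ s * (z⁻¹ * Real.exp t + θ)⁻¹) Filter.atTop
      (nhds 0) := by
    obtain ⟨C, h⟩ := exists_inv_denom_le hθ hz
    have hC := (tendsto_rpow_mul_exp_neg_mul_atTop_nhds_zero s 1 one_pos).const_mul C
    rw [mul_zero] at hC
    refine squeeze_zero' ?_ ?_ hC
    · filter_upwards [Filter.eventually_ge_atTop 0] with t ht
      exact mul_nonneg (Real.rpow_nonneg ht s) (inv_pos.2 (denom_pos hθ hz ht)).le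
    · filter_upwards [Filter.eventually_ge_atTop 0] with t ht
      have := mul_le_mul_of_nonneg_left (h t ht) (Real.rpow_nonneg ht s)
      rw [neg_one_mul]
      linarith
  have key := integral_Ioi_of_hasDerivAt_of_tendsto hcont hderiv (hI₁.sub hI₂) hlim
  rw [integral_sub hI₁ hI₂, integral_const_mul, Real.zero_rpow hs.ne', zero_mul, sub_zero] at key
  exact sub_eq_zero.1 key

theorem occupationMoment_eq (hθ : θ = -1 ∨ θ = 0 ∨ θ = 1) (hz : admissible θ z) {s : ℝ}
    (hs : 0 < s) : occupationMoment θ z s = Real.Gamma (s + 1) * qpolylog θ s z := by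
  have hΓ := (Real.Gamma_pos_of_pos hs).ne'
  rw [← integral_rpow_mul_inv_denom hθ hz hs, Real.Gamma_add_one hs.ne', qpolylog]
  simp only [div_eq_mul_inv]
  field_simp

/-- A nonnegative integrable function that vanishes at one point at most has positive integral. -/
theorem setIntegral_pos_of_pos_of_ne {f : ℝ → ℝ} (c : ℝ)
    (hf : IntegrableOn f (Set.Ioi 0)) (h₀ : ∀ t > 0, 0 ≤ f t) (h : ∀ t > 0, t ≠ c → 0 < f t) :
    0 < ∫ t in Set.Ioi (0:ℝ), f t := by
  rw [setIntegral_pos_iff_support_of_nonneg_ae _ hf]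
  · have hsub : Set.Ioi (0:ℝ) \ {c} ⊆ Function.support f ∩ Set.Ioi 0 :=
      fun t ht => ⟨(h t ht.1 ht.2).ne', ht.1⟩
    refine lt_of_lt_of_le ?_ (measure_mono hsub)
    rw [measure_sdiff_null (by simp)]
    simp
  · filter_upwards [ae_restrict_mem measurableSet_Ioi] with t ht using h₀ t ht

theorem occupationMoment_pos (hθ : θ = -1 ∨ θ = 0 ∨ θ = 1) (hz : admissible θ z) {p : ℝ}
    (hp : -1 < p) : 0 < occupationMoment θ z p := by
  have h : ∀ t > 0, 0 < t ^ p * occupationDecay θ z t := fun t ht =>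
    mul_pos (Real.rpow_pos_of_pos ht p) (occupationDecay_pos hθ hz (le_of_lt ht))
  exact setIntegral_pos_of_pos_of_ne 0 (integrableOn_rpow_mul_occupationDecay hθ hz hp)
    (fun t ht => (h t ht).le) fun t ht _ => h t ht

/-- The strict Cauchy–Schwarz inequality for the moments. -/
theorem occupationMoment_sq_lt (hθ : θ = -1 ∨ θ = 0 ∨ θ = 1) (hz : admissible θ z) {p : ℝ}
    (hp : -1 < p) :
    occupationMoment θ z (p + 1) ^ 2 < occupationMoment θ z p * occupationMoment θ z (p + 2) := by
  have h₀ := integrableOn_rpow_mul_occupationDecay hθ hz hp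
  have h₁ := integrableOn_rpow_mul_occupationDecay hθ hz (p := p + 1) (by linarith)
  have h₂ := integrableOn_rpow_mul_occupationDecay hθ hz (p := p + 2) (by linarith)
  have hI := occupationMoment_pos hθ hz hp
  set c := occupationMoment θ z (p + 1) / occupationMoment θ z p with hc
  have hc₁ := h₁.const_mul (2 * c)
  have hc₀ := h₀.const_mul (c ^ 2)
  have hfac : ∀ t > 0, t ^ (p + 2) * occupationDecay θ z t
      - 2 * c * (t ^ (p + 1) * occupationDecay θ z t) + c ^ 2 * (t ^ p * occupationDecay θ z t) =
      (t - c) ^ 2 * (t ^ p * occupationDecay θ z t) := by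
    intro t ht
    rw [Real.rpow_add ht, Real.rpow_add ht, Real.rpow_one, Real.rpow_two]
    ring
  have hw : ∀ t > 0, 0 < t ^ p * occupationDecay θ z t := fun t ht =>
    mul_pos (Real.rpow_pos_of_pos ht p) (occupationDecay_pos hθ hz (le_of_lt ht))
  have hpos := setIntegral_pos_of_pos_of_ne c ((h₂.sub hc₁).add hc₀)
    (fun t ht => (mul_nonneg (sq_nonneg _) (hw t ht).le).trans_eq (hfac t ht).symm)
    (fun t ht htc => (mul_pos (sq_pos_of_ne_zero (sub_ne_zero.2 htc)) (hw t ht)).trans_eq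
      (hfac t ht).symm)
  rw [integral_add' (h₂.sub hc₁) hc₀, integral_sub' h₂ hc₁, integral_const_mul,
    integral_const_mul] at hpos
  change 0 < occupationMoment θ z (p + 2) - 2 * c * occupationMoment θ z (p + 1)
    + c ^ 2 * occupationMoment θ z p at hpos
  have hcI : c * occupationMoment θ z p = occupationMoment θ z (p + 1) := by
    rw [hc, div_mul_cancel₀ _ hI.ne']
  have := mul_pos hI hpos
  rw [← hcI] at this ⊢
  nlinarith [this]

theorem qpolylog_pos (hθ : θ = -1 ∨ θ = 0 ∨ θ = 1) (hz : admissible θ z) {s : ℝ}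
    (hs : 0 < s) : 0 < qpolylog θ s z := by
  have h := occupationMoment_pos hθ hz (p := s) (by linarith)
  rw [occupationMoment_eq hθ hz hs] at h
  exact pos_of_mul_pos_right h (Real.Gamma_pos_of_pos (by linarith)).le

theorem qpolylog_sq_lt (hθ : θ = -1 ∨ θ = 0 ∨ θ = 1) (hz : admissible θ z) {s : ℝ}
    (hs : 0 < s) :
    (s + 1) * qpolylog θ (s + 1) z ^ 2 < (s + 2) * (qpolylog θ s z * qpolylog θ (s + 2) z) := by
  have h := occupationMoment_sq_lt hθ hz (p := s) (by linarith)
  rw [occupationMoment_eq hθ hz hs, occupationMoment_eq hθ hz (s := s + 1) (by linarith),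
    occupationMoment_eq hθ hz (s := s + 2) (by linarith), show s + 2 + 1 = s + 1 + 1 + 1 by ring,
    Real.Gamma_add_one (s := s + 1 + 1) (by linarith),
    Real.Gamma_add_one (s := s + 1) (by linarith)] at h
  have hΓ := Real.Gamma_pos_of_pos (show 0 < s + 1 by linarith)
  have hk : 0 < (s + 1) * Real.Gamma (s + 1) ^ 2 := by positivity
  refine lt_of_mul_lt_mul_left ?_ hk.le
  linarith

end Moments

theorem eigenSpan_blockMatrix_moment_eq_top {m₁ m₃ b r : ℝ} (hm₁ : 0 < m₁) (hm₃ : 0 < m₃)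
    (hb : 2 / 5 < b) (hbr : b * (5 - 3 * r) = 2) :
    eigenSpan (blockMatrix (m₁ * r) (1 + 1 / 2 * (1 - r)) (1 / 2 * (1 - r)) (2 * m₁)
      (2 * b / 3 + 8 / 15) (2 * b / 3 - 4 / 15) (m₃ + 2 * m₁ / 3) (m₃ - m₁ / 3)
      m₁).mulVecLin = ⊤ := by
  refine eigenSpan_blockMatrix_eq_top (t := 3 * m₁ + (2 * b * m₃ + 8 * m₁ / 15))
    (d := 6 * m₁ * m₃ * (b - 2 / 5)) hm₁ (by ring) ?_ ?_ ?_ ?_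
  · linear_combination (m₃ + 2 * m₁ / 3) * (2 * m₁) / 3 * hbr
  · have : 0 < b * m₃ := mul_pos (by linarith) hm₃
    linarith
  · have : 0 < b - 2 / 5 := by linarith
    positivity
  · have h₁ : 0 < m₁ * (m₃ + 2 * m₁ / 3) := by positivity
    have h₂ := sq_nonneg (3 * m₁ - (2 * b * m₃ + 8 * m₁ / 15))
    linarith

theorem eigenSpan_M1_eq_top {θ z T : ℝ} (hθ : θ = -1 ∨ θ = 0 ∨ θ = 1) (hz : admissible θ z)
    (hT : 0 < T) : eigenSpan (M1 θ z T).mulVecLin = ⊤ := by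
  have h₁ : 0 < qpolylog θ (1 / 2) z := qpolylog_pos hθ hz (by norm_num)
  have h₃ : 0 < qpolylog θ (3 / 2) z := qpolylog_pos hθ hz (by norm_num)
  have h₅ : 0 < qpolylog θ (5 / 2) z := qpolylog_pos hθ hz (by norm_num)
  have h₇ : 0 < qpolylog θ (7 / 2) z := qpolylog_pos hθ hz (by norm_num)
  have hlow := qpolylog_sq_lt hθ hz (s := 1 / 2) (by norm_num)
  have hhigh := qpolylog_sq_lt hθ hz (s := 3 / 2) (by norm_num)
  norm_num only at hlow hhigh
  unfold M1
  norm_num only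
  generalize qpolylog θ (1 / 2) z = L₁ at *
  generalize qpolylog θ (3 / 2) z = L₃ at *
  generalize qpolylog θ (5 / 2) z = L₅ at *
  generalize qpolylog θ (7 / 2) z = L₇ at *
  have hr : 3 * L₅ ^ 2 / (L₃ * L₇) < 21 / 5 := by
    rw [div_lt_iff₀ (by positivity)]
    linarith
  have hr₀ : 0 < 3 * L₅ ^ 2 / (L₃ * L₇) := by positivity
  have hspeed : 0 < 5 * L₁ / L₃ - 3 * L₃ / L₅ := by
    rw [sub_pos, div_lt_div_iff₀ h₅ h₃]
    linarith
  have hheat : 0 < 2 * L₁ * L₇ / (L₃ * L₅) - 3 * (1 - L₃ * L₇ / L₅ ^ 2) := by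
    have key : 0 < 2 * L₁ * L₇ * L₅ + 3 * L₃ ^ 2 * L₇ - 3 * L₃ * L₅ ^ 2 := by
      have e₁ := mul_pos h₇ (sub_pos.2 hlow)
      have e₂ := mul_pos h₃ (sub_pos.2 hhigh)
      linarith
    rw [show 2 * L₁ * L₇ / (L₃ * L₅) - 3 * (1 - L₃ * L₇ / L₅ ^ 2) =
      (2 * L₁ * L₇ * L₅ + 3 * L₃ ^ 2 * L₇ - 3 * L₃ * L₅ ^ 2) / (L₃ * L₅ ^ 2) by field_simp; ring]
    positivity
  have hb : 2 / 5 < 2 / (5 - 3 * L₅ ^ 2 / (L₃ * L₇)) := by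
    rw [div_lt_div_iff₀ (by norm_num) (by linarith)]
    linarith
  have hbr : 2 / (5 - 3 * L₅ ^ 2 / (L₃ * L₇)) * (5 - 3 * (L₅ ^ 2 / (L₃ * L₇))) = 2 := by
    rw [← mul_div_assoc 3, div_mul_cancel₀ _ (by linarith)]
  generalize 2 / (5 - 3 * L₅ ^ 2 / (L₃ * L₇)) = b at *
  have hb₀ : 0 < b := by linarith
  have hm₃ : 0 < 5 / (6 * b) * (T / (5 * L₁ / L₃ - 3 * L₃ / L₅)) *
      (2 * L₁ * L₇ / (L₃ * L₅) - 3 * (1 - L₃ * L₇ / L₅ ^ 2)) := by positivity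
  have htop := eigenSpan_blockMatrix_moment_eq_top (m₁ := L₇ / L₅ * T) (by positivity) hm₃ hb hbr
  rw [show L₇ / L₅ * T * (L₅ ^ 2 / (L₃ * L₇)) = T * L₅ / L₃ by field_simp] at htop
  exact htop

/-- Global hyperbolicity of the regularized quantum 13-moment system: for every
statistics parameter `θ ∈ {-1, 0, 1}`, every admissible fugacity `z`, and every
temperature `T > 0`, the matrix `M₁` has only real eigenvalues and is
diagonalizable over `ℝ`. -/
theorem M1_real_diagonalizable
    (θ z T : ℝ) (hθ : θ = -1 ∨ θ = 0 ∨ θ = 1) (hz : admissible θ z) (hT : 0 < T) :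
    (∀ μ ∈ ((M1 θ z T).map (algebraMap ℝ ℂ)).charpoly.roots, μ.im = 0) ∧
      ∃ P : Matrix (Fin 13) (Fin 13) ℝ, IsUnit P.det ∧ (P⁻¹ * M1 θ z T * P).IsDiag := by
  obtain ⟨P, hP, hdiag⟩ := exists_isDiag_of_eigenSpan_eq_top (eigenSpan_M1_eq_top hθ hz hT)
  exact ⟨charpoly_roots_real_of_isDiag hP hdiag, P, hP, hdiag⟩
end

section
/- The ratio z ↦ 𝓛_{5/2}(z)/𝓛_{3/2}(z) is strictly increasing on (0, ∞) for Fermions (θ = 1) and strictly decreasing on (0, 1) for Bosons (θ = −1). -/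
open Real

open MeasureTheory in
theorem setIntegral_Ioi_pos_of_pos {f : ℝ → ℝ} {a m : ℝ} (ham : a ≤ m)
    (hf : IntegrableOn f (Set.Ioi a)) (h0 : ∀ t, a < t → 0 ≤ f t) (hm : ∀ t, m < t → 0 < f t) :
    0 < ∫ t in Set.Ioi a, f t := by
  rw [setIntegral_pos_iff_support_of_nonneg_ae
    ((ae_restrict_iff' measurableSet_Ioi).2 (.of_forall h0)) hf]
  refine lt_of_lt_of_le (b := volume (Set.Ioi m)) (by simp) (measure_mono fun t ht => ?_)
  exact ⟨(hm t ht).ne', ham.trans_lt ht⟩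

open MeasureTheory in
/-- Strict monotone likelihood ratio of two weights on `(0, ∞)` implies strict order of their
means. -/
theorem mean_lt_mean_of_likelihood_ratio {v w : ℝ → ℝ}
    (hv : IntegrableOn v (Set.Ioi 0)) (hw : IntegrableOn w (Set.Ioi 0))
    (hv' : IntegrableOn (fun t => t * v t) (Set.Ioi 0))
    (hw' : IntegrableOn (fun t => t * w t) (Set.Ioi 0))
    (hv0 : ∀ t, 0 < t → 0 < v t) (hw0 : ∀ t, 0 < t → 0 < w t)
    (hlt : ∀ s t, 0 < s → s < t → w s * v t < w t * v s) :
    (∫ t in Set.Ioi (0:ℝ), t * v t) / (∫ t in Set.Ioi (0:ℝ), v t) <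
      (∫ t in Set.Ioi (0:ℝ), t * w t) / (∫ t in Set.Ioi (0:ℝ), w t) := by
  have hV : 0 < ∫ t in Set.Ioi (0:ℝ), v t :=
    setIntegral_Ioi_pos_of_pos le_rfl hv (fun t ht => (hv0 t ht).le) hv0
  have hW : 0 < ∫ t in Set.Ioi (0:ℝ), w t :=
    setIntegral_Ioi_pos_of_pos le_rfl hw (fun t ht => (hw0 t ht).le) hw0
  have hV' : 0 < ∫ t in Set.Ioi (0:ℝ), t * v t :=
    setIntegral_Ioi_pos_of_pos le_rfl hv' (fun t ht => (mul_pos ht (hv0 t ht)).le)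
      fun t ht => mul_pos ht (hv0 t ht)
  set m := (∫ t in Set.Ioi (0:ℝ), t * v t) / (∫ t in Set.Ioi (0:ℝ), v t) with hm
  have hm0 : 0 < m := div_pos hV' hV
  have hmV : ∫ t in Set.Ioi (0:ℝ), t * v t = m * ∫ t in Set.Ioi (0:ℝ), v t := by
    rw [hm, div_mul_cancel₀ _ hV.ne']
  have hiv : IntegrableOn (fun t => t * v t - m * v t) (Set.Ioi 0) := hv'.sub (hv.const_mul m)
  have hiw : IntegrableOn (fun t => t * w t - m * w t) (Set.Ioi 0) := hw'.sub (hw.const_mul m)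
  have key : 0 < ∫ t in Set.Ioi (0:ℝ),
      (v m * (t * w t - m * w t) - w m * (t * v t - m * v t)) := by
    refine setIntegral_Ioi_pos_of_pos hm0.le ((hiw.const_mul (v m)).sub (hiv.const_mul (w m)))
      (fun t ht => ?_) fun t ht => ?_
    · rcases lt_trichotomy t m with h | rfl | h
      · nlinarith [mul_pos (sub_pos.2 h) (sub_pos.2 (hlt t m ht h))]
      · simp
      · nlinarith [mul_pos (sub_pos.2 h) (sub_pos.2 (hlt m t hm0 h))]
    · nlinarith [mul_pos (sub_pos.2 ht) (sub_pos.2 (hlt m t hm0 ht))]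
  rw [integral_sub (hiw.const_mul (v m)) (hiv.const_mul (w m)), integral_const_mul,
    integral_const_mul, integral_sub hv' (hv.const_mul m), integral_sub hw' (hw.const_mul m),
    integral_const_mul, integral_const_mul, hmV, sub_self, mul_zero, sub_zero] at key
  rw [lt_div_iff₀ hW]
  exact sub_pos.1 (pos_of_mul_pos_right key (hv0 m hm0).le)

open MeasureTheory in
theorem integrableOn_rpow_div_mul_exp_add {θ a s : ℝ} (ha : 0 < a) (haθ : 0 < a + θ)
    (hs : 0 < s) :
    IntegrableOn (fun t : ℝ => t ^ (s - 1) / (a * Real.exp t + θ)) (Set.Ioi 0) := by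
  have hc : 0 < min a (a + θ) := lt_min ha haθ
  refine ((Real.GammaIntegral_convergent hs).const_mul (min a (a + θ))⁻¹).mono'
    (Measurable.aestronglyMeasurable (by fun_prop)) ?_
  refine (ae_restrict_iff' measurableSet_Ioi).2 (.of_forall fun t (ht : 0 < t) => ?_)
  have he : 1 < Real.exp t := Real.one_lt_exp_iff.2 ht
  have hle : min a (a + θ) * Real.exp t ≤ a * Real.exp t + θ := by
    rcases le_total 0 θ with h | h
    · nlinarith [min_le_left a (a + θ)]
    · nlinarith [min_le_right a (a + θ)]
  have hpos : 0 < min a (a + θ) * Real.exp t := by positivity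
  have hr : 0 ≤ t ^ (s - 1) := by positivity
  rw [Real.norm_of_nonneg (div_nonneg hr (hpos.trans_le hle).le)]
  calc t ^ (s - 1) / (a * Real.exp t + θ) ≤ t ^ (s - 1) / (min a (a + θ) * Real.exp t) := by
        gcongr
    _ = (min a (a + θ))⁻¹ * (Real.exp (-t) * t ^ (s - 1)) := by
        rw [Real.exp_neg]; field_simp

theorem qpolylog_ratio_lt {θ x y : ℝ} (hx : 0 < x) (hy : 0 < y) (hxθ : 0 < x⁻¹ + θ)
    (hyθ : 0 < y⁻¹ + θ) (h : 0 < θ * (x⁻¹ - y⁻¹)) :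
    qpolylog θ (5/2) x / qpolylog θ (3/2) x < qpolylog θ (5/2) y / qpolylog θ (3/2) y := by
  have hd : ∀ a t : ℝ, 0 < a → 0 < a + θ → 0 < t → 0 < a * Real.exp t + θ := by
    intro a t ha haθ ht
    nlinarith [Real.one_lt_exp_iff.2 ht]
  have hmul : ∀ a t : ℝ, 0 < t →
      t ^ ((5/2 : ℝ) - 1) / (a * Real.exp t + θ) =
        t * (t ^ ((3/2 : ℝ) - 1) / (a * Real.exp t + θ)) := by
    intro a t ht
    rw [show (5/2 : ℝ) - 1 = 1 + (3/2 - 1) by norm_num, Real.rpow_add ht, Real.rpow_one,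
      mul_div_assoc]
  have hint : ∀ a : ℝ, 0 < a → 0 < a + θ → MeasureTheory.IntegrableOn
      (fun t : ℝ => t * (t ^ ((3/2 : ℝ) - 1) / (a * Real.exp t + θ))) (Set.Ioi 0) :=
    fun a ha haθ => (integrableOn_rpow_div_mul_exp_add ha haθ (by norm_num)).congr_fun
      (fun t ht => hmul a t ht) measurableSet_Ioi
  have hx' := inv_pos.2 hx
  have hy' := inv_pos.2 hy
  have key := mean_lt_mean_of_likelihood_ratio
    (integrableOn_rpow_div_mul_exp_add (s := 3/2) hx' hxθ (by norm_num))
    (integrableOn_rpow_div_mul_exp_add (s := 3/2) hy' hyθ (by norm_num))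
    (hint _ hx' hxθ) (hint _ hy' hyθ)
    (fun t ht => div_pos (Real.rpow_pos_of_pos ht _) (hd _ t hx' hxθ ht))
    (fun t ht => div_pos (Real.rpow_pos_of_pos ht _) (hd _ t hy' hyθ ht))
    (fun s t hs hst => by
      have ht := hs.trans hst
      have h1 := hd _ s hx' hxθ hs
      have h2 := hd _ t hx' hxθ ht
      have h3 := hd _ s hy' hyθ hs
      have h4 := hd _ t hy' hyθ ht
      have hp := mul_pos (Real.rpow_pos_of_pos hs ((3/2 : ℝ) - 1))
        (Real.rpow_pos_of_pos ht ((3/2 : ℝ) - 1))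
      rw [div_mul_div_comm, div_mul_div_comm, mul_comm (t ^ ((3/2 : ℝ) - 1))]
      refine div_lt_div_of_pos_left hp (mul_pos h4 h1) ?_
      nlinarith [mul_pos h (sub_pos.2 (Real.exp_lt_exp.2 hst))])
  simp only [qpolylog]
  rw [MeasureTheory.setIntegral_congr_fun measurableSet_Ioi (fun t ht => hmul x⁻¹ t ht),
    MeasureTheory.setIntegral_congr_fun measurableSet_Ioi (fun t ht => hmul y⁻¹ t ht),
    mul_div_mul_comm, mul_div_mul_comm]
  have h5 := Real.Gamma_pos_of_pos (s := 5/2) (by norm_num)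
  have h3 := Real.Gamma_pos_of_pos (s := 3/2) (by norm_num)
  exact mul_lt_mul_of_pos_left key (by positivity)


/-- The ratio `𝓛_{5/2}(z)/𝓛_{3/2}(z)` is strictly increasing on `(0, ∞)` for Fermions
(`θ = 1`) and strictly decreasing on `(0, 1)` for Bosons (`θ = -1`). -/
theorem qpolylog_ratio_monotone :
    StrictMonoOn (fun z => qpolylog 1 (5/2) z / qpolylog 1 (3/2) z) (Set.Ioi 0) ∧
    StrictAntiOn (fun z => qpolylog (-1) (5/2) z / qpolylog (-1) (3/2) z)
      (Set.Ioo 0 1) := by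
  refine ⟨fun x hx y hy hxy => ?_, fun x hx y hy hxy => ?_⟩
  · have hx : 0 < x := hx
    have hy : 0 < y := hy
    have := inv_strictAnti₀ hx hxy
    exact qpolylog_ratio_lt hx hy (by positivity) (by positivity) (by linarith)
  · have := inv_strictAnti₀ hx.1 hxy
    have := (one_lt_inv₀ hx.1).2 hx.2
    have := (one_lt_inv₀ hy.1).2 hy.2
    exact qpolylog_ratio_lt hy.1 hx.1 (by linarith) (by linarith) (by linarith)
end
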